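/- arXiv:2508.13289 — 4 statements merged into one kernel-verified Lean document; each statement's English description precedes it below -/
import Mathlib

section
/- Let X be an n-correct set and let q be a polynomial of degree k with 1 ≤ k ≤ n whose zero set contains exactly d(n,k) nodes of X. Then q is a maximal curve for X if and only if the set X \ q of nodes of X not lying on q is an (n−k)-correct set. -/
open MvPolynomial Finset
open scoped Classical BigOperators

noncomputable section

/-- Points of the plane. -/
abbrev Pt : Type := Fin 2 → ℝ

/-- Bivariate real polynomials. -/
abbrev Poly2 : Type := MvPolynomial (Fin 2) ℝ

/-- `N = dim Π_n = (n+1)(n+2)/2`. -/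
def Nn (n : ℕ) : ℕ := (n + 1) * (n + 2) / 2

/-- `X` is an `n`-correct set of nodes: it has `N` nodes and the only polynomial of total
degree at most `n` vanishing at all of them is the zero polynomial. -/
def IsNCorrect (n : ℕ) (X : Finset Pt) : Prop :=
  X.card = Nn n ∧
  ∀ p : Poly2, p.totalDegree ≤ n → (∀ P ∈ X, eval P p = 0) → p = 0

/-- A line: a (nonzero) polynomial of total degree exactly 1. -/
def IsLine (ℓ : Poly2) : Prop := ℓ.totalDegree = 1

/-- The zero set of a polynomial, as a subset of the plane. -/
def zeroSet (q : Poly2) : Set Pt := {P : Pt | eval P q = 0}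

/-- `X ∩ q` : the nodes of `X` lying on the curve `q`. -/
def zerosIn (X : Finset Pt) (q : Poly2) : Finset Pt := X.filter fun P => eval P q = 0

/-- `X \ q` : the nodes of `X` not lying on the curve `q`. -/
def nonzerosIn (X : Finset Pt) (q : Poly2) : Finset Pt := X.filter fun P => eval P q ≠ 0

/-- `ℓ` is a maximal line for (an `n`-correct set) `X`: a line passing through
exactly `n+1` nodes. -/
def IsMaximalLine (n : ℕ) (X : Finset Pt) (ℓ : Poly2) : Prop :=
  IsLine ℓ ∧ (zerosIn X ℓ).card = n + 1

/-- The collection of maximal lines of `X` (as subsets of the plane). -/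
def maximalLines (n : ℕ) (X : Finset Pt) : Set (Set Pt) :=
  {Z : Set Pt | ∃ ℓ : Poly2, IsMaximalLine n X ℓ ∧ Z = zeroSet ℓ}

/-- `p` is the `n`-fundamental polynomial of the node `A` of `X`. -/
def IsFund (n : ℕ) (X : Finset Pt) (A : Pt) (p : Poly2) : Prop :=
  p.totalDegree ≤ n ∧ eval A p = 1 ∧ ∀ P ∈ X, P ≠ A → eval P p = 0

/-- The node `A` of `X` uses the curve `q`: `q` divides the fundamental polynomial of `A`. -/
def Uses (n : ℕ) (X : Finset Pt) (A : Pt) (q : Poly2) : Prop :=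
  ∃ p : Poly2, IsFund n X A p ∧ q ∣ p

/-- `d(n,k) = k(2n+3-k)/2`. -/
def d (n k : ℕ) : ℕ := k * (2 * n + 3 - k) / 2

/-- `q` is a maximal curve of degree `k` for `X`: it passes through exactly `d(n,k)` nodes. -/
def IsMaximalCurve (n k : ℕ) (X : Finset Pt) (q : Poly2) : Prop :=
  q.totalDegree = k ∧ (zerosIn X q).card = d n k

/-- `{A,B,C}` is a special triplet of the `n`-correct set `X` : there is a maximal curve `f`
of degree `n-1` with `X \ f = {A,B,C}`. -/
def IsSpecialTriplet (n : ℕ) (X : Finset Pt) (A B C : Pt) : Prop :=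
  A ∈ X ∧ B ∈ X ∧ C ∈ X ∧ A ≠ B ∧ A ≠ C ∧ B ≠ C ∧
  ∃ f : Poly2, IsMaximalCurve n (n - 1) X f ∧ nonzerosIn X f = {A, B, C}

/-- `X` is a `GC_n` set: an `n`-correct set in which every fundamental polynomial is a
product of `n` linear factors. -/
def IsGC (n : ℕ) (X : Finset Pt) : Prop :=
  IsNCorrect n X ∧
  ∀ A ∈ X, ∃ p : Poly2, IsFund n X A p ∧
    ∃ g : Fin n → Poly2, (∀ i, (g i).totalDegree = 1) ∧ p = ∏ i, g i

/-- `ℓ` is a line passing through the points `P` and `Q` (in particular, `ℓ_{PQ}` when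
`P ≠ Q`). -/
def IsLineThrough (ℓ : Poly2) (P Q : Pt) : Prop :=
  IsLine ℓ ∧ eval P ℓ = 0 ∧ eval Q ℓ = 0

/-- `ℓ` is a `2`-node line of `X` passing through exactly the two nodes `A` and `B`. -/
def IsTwoNodeLineOf (X : Finset Pt) (ℓ : Poly2) (A B : Pt) : Prop :=
  IsLine ℓ ∧ A ≠ B ∧ zerosIn X ℓ = {A, B}

/-- `Y` is an `n`-independent set: every point has an `n`-fundamental polynomial. -/
def IsNIndependent (n : ℕ) (Y : Finset Pt) : Prop :=
  ∀ A ∈ Y, ∃ p : Poly2, p.totalDegree ≤ n ∧ eval A p ≠ 0 ∧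
    ∀ P ∈ Y, P ≠ A → eval P p = 0

/-- A family of lines is in general position: no two parallel (or equal) — i.e. any two of
them meet in a unique point — and no three concurrent. -/
def GenPos {m : ℕ} (ℓ : Fin m → Poly2) : Prop :=
  (∀ i, IsLine (ℓ i)) ∧
  (∀ i j, i ≠ j → ∃! P : Pt, eval P (ℓ i) = 0 ∧ eval P (ℓ j) = 0) ∧
  (∀ i j k, i ≠ j → i ≠ k → j ≠ k →
    ¬∃ P : Pt, eval P (ℓ i) = 0 ∧ eval P (ℓ j) = 0 ∧ eval P (ℓ k) = 0)

/-- `X` is a Chung–Yao set of degree `n`: the set of pairwise intersection points of `n+2`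
lines in general position. -/
def IsChungYao (n : ℕ) (X : Finset Pt) : Prop :=
  ∃ ℓ : Fin (n + 2) → Poly2, GenPos ℓ ∧
    (↑X : Set Pt) = {P : Pt | ∃ i j, i ≠ j ∧ eval P (ℓ i) = 0 ∧ eval P (ℓ j) = 0}

/-- `X` is a Carnicer–Gasca set of degree `n`: the pairwise intersection points of `n+1`
lines in general position together with one extra point `A i` on each line `ℓ i`, the `A i`
lying on no other line of the family and not all collinear. -/
def IsCarnicerGasca (n : ℕ) (X : Finset Pt) : Prop :=
  ∃ (ℓ : Fin (n + 1) → Poly2) (A : Fin (n + 1) → Pt), GenPos ℓ ∧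
    (∀ i j, eval (A i) (ℓ j) = 0 ↔ j = i) ∧
    (¬∃ L : Poly2, IsLine L ∧ ∀ i, eval (A i) L = 0) ∧
    (↑X : Set Pt) =
      {P : Pt | ∃ i j, i ≠ j ∧ eval P (ℓ i) = 0 ∧ eval P (ℓ j) = 0} ∪ Set.range A

/-- The dimension of `Π_n` splits as `d(n,k)` plus the dimension of `Π_{n-k}`. -/
theorem d_add_Nn_sub {n k : ℕ} (hkn : k ≤ n) : d n k + Nn (n - k) = Nn n := by
  obtain ⟨m, rfl⟩ := Nat.exists_eq_add_of_le' hkn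
  have h : 2 * (m + k) + 3 - k = 2 * m + k + 3 := by omega
  have hm : 2 ∣ (m + 1) * (m + 2) := (Nat.even_mul_succ_self (m + 1)).two_dvd
  simp only [d, Nn, Nat.add_sub_cancel, h]
  rw [← Nat.add_div_of_dvd_left hm]
  congr 1
  ring

/-- Deleting the nodes on a curve of degree `k` keeps unisolvence, in degree `n - k`. -/
theorem eq_zero_of_vanish_nonzerosIn {n : ℕ} {X : Finset Pt} (hX : IsNCorrect n X)
    {q : Poly2} (hq : q ≠ 0) (hqn : q.totalDegree ≤ n) {p : Poly2}
    (hp : p.totalDegree ≤ n - q.totalDegree)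
    (hv : ∀ P ∈ nonzerosIn X q, eval P p = 0) : p = 0 := by
  have hpq : p * q = 0 := by
    refine hX.2 _ ((totalDegree_mul p q).trans (by omega)) fun P hP => ?_
    rw [map_mul]
    by_cases h : eval P q = 0
    · rw [h, mul_zero]
    · rw [hv P (Finset.mem_filter.2 ⟨hP, h⟩), zero_mul]
  exact (mul_eq_zero.1 hpq).resolve_right hq

/-- for a curve `q` of degree `k`, `1 ≤ k ≤ n`, passing through exactly
`d(n,k)` nodes of the `n`-correct set `X`: `q` is a maximal curve for `X` iff `X \ q`
is an `(n-k)`-correct set. -/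
theorem maximal_curve_iff_complement_correct (n k : ℕ) (X : Finset Pt)
    (hX : IsNCorrect n X) (q : Poly2) (hk1 : 1 ≤ k) (hkn : k ≤ n)
    (hdeg : q.totalDegree = k) (hcard : (zerosIn X q).card = d n k) :
    IsMaximalCurve n k X q ↔ IsNCorrect (n - k) (nonzerosIn X q) := by
  refine ⟨fun _ => ⟨?_, fun p hp hv => ?_⟩, fun _ => ⟨hdeg, hcard⟩⟩
  · have hsplit : (zerosIn X q).card + (nonzerosIn X q).card = X.card :=
      Finset.card_filter_add_card_filter_not (s := X) fun P => eval P q = 0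
    have hN := d_add_Nn_sub hkn
    have hXcard := hX.1
    omega
  · have hq : q ≠ 0 := by
      rintro rfl
      rw [totalDegree_zero] at hdeg
      omega
    exact eq_zero_of_vanish_nonzerosIn hX hq (hdeg.trans_le hkn) (hdeg ▸ hp) hv
end
end

section
/- Let X be an n-correct set and let q be a maximal curve for X of degree k ≤ n. Suppose a curve s of degree m ≤ k is a component of q, i.e., q = s·r with deg r = k−m. Then s passes through at least d(n−k+m, m) nodes of X \ r. Moreover, s passes through exactly d(n−k+m, m) nodes of X \ r if and only if r is a maximal curve for X of degree k−m. -/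
open MvPolynomial Finset
open scoped Classical BigOperators

noncomputable section

theorem two_mul_Nn (n : ℕ) : 2 * Nn n = (n + 1) * (n + 2) :=
  Nat.two_mul_div_two_of_even (Nat.even_mul_succ_self (n + 1))

theorem card_sigma_fin_succ (j : ℕ) : Fintype.card (Σ i : Fin (j + 1), Fin (i + 1)) = Nn j := by
  have key : ∀ m : ℕ, 2 * ∑ i ∈ Finset.range m, (i + 1) = m * (m + 1) := by
    intro m
    induction m with
    | zero => simp
    | succ m ih => rw [Finset.sum_range_succ, mul_add, ih]; ring
  have h : Fintype.card (Σ i : Fin (j + 1), Fin (i + 1)) = ∑ i ∈ Finset.range (j + 1), (i + 1) := by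
    simp [Fintype.card_sigma, Finset.sum_range]
  have h1 := key (j + 1)
  have h2 := two_mul_Nn j
  rw [h]
  linarith

/-- The bivariate exponent vector `(b, i - b)`. -/
def planeExponent (j : ℕ) (x : Σ i : Fin (j + 1), Fin (i + 1)) : Fin 2 →₀ ℕ :=
  Finsupp.single 0 (x.2 : ℕ) + Finsupp.single 1 ((x.1 : ℕ) - x.2)

theorem planeExponent_injective (j : ℕ) : Function.Injective (planeExponent j) := by
  rintro ⟨⟨i, hi⟩, ⟨b, hb⟩⟩ ⟨⟨i', hi'⟩, ⟨b', hb'⟩⟩ h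
  have h0 := DFunLike.congr_fun h 0
  have h1 := DFunLike.congr_fun h 1
  simp [planeExponent] at h0 h1 hb hb'
  obtain rfl : b = b' := h0
  obtain rfl : i = i' := by omega
  rfl

/-- Any fewer than `Nn j` points lie on the zero set of some nonzero polynomial of degree at most `j`. -/
theorem exists_ne_zero_vanishing (j : ℕ) (Y : Finset Pt) (hY : Y.card < Nn j) :
    ∃ p : Poly2, p ≠ 0 ∧ p.totalDegree ≤ j ∧ ∀ P ∈ Y, eval P p = 0 := by
  let I := Σ i : Fin (j + 1), Fin (i + 1)
  let poly : (I → ℝ) →ₗ[ℝ] Poly2 :=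
    ∑ x : I, (monomial (planeExponent j x)).comp (LinearMap.proj x)
  have poly_apply (c : I → ℝ) : poly c = ∑ x : I, monomial (planeExponent j x) (c x) := by
    simp [poly]
  let L : (I → ℝ) →ₗ[ℝ] (Y → ℝ) :=
    LinearMap.pi fun P => (aeval (R := ℝ) (P : Pt)).toLinearMap.comp poly
  have hL : LinearMap.ker L ≠ ⊥ := by
    apply LinearMap.ker_ne_bot_of_finrank_lt
    simpa [I, card_sigma_fin_succ, -Fintype.card_sigma] using hY
  obtain ⟨c, hc, hc0⟩ := Submodule.exists_mem_ne_zero_of_ne_bot hL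
  refine ⟨poly c, fun h => hc0 ?_, ?_, fun P hP => ?_⟩
  · ext x
    have hx := congrArg (coeff (planeExponent j x)) h
    simp only [poly_apply, coeff_sum, coeff_monomial, (planeExponent_injective j).eq_iff,
      coeff_zero] at hx
    rw [Finset.sum_eq_single x (fun y _ h => if_neg h) (by simp)] at hx
    simpa using hx
  · rw [poly_apply]
    refine totalDegree_finsetSum_le fun x _ => (totalDegree_monomial_le _ _).trans ?_
    have h1 := x.1.isLt
    have h2 := x.2.isLt
    rw [planeExponent, Finsupp.sum_add_index' (by simp) (by simp),
      Finsupp.sum_single_index rfl, Finsupp.sum_single_index rfl]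
    simp only [id_eq]
    omega
  · have := congrFun (LinearMap.mem_ker.mp hc) ⟨P, hP⟩
    simpa [L, aeval_eq_eval] using this

theorem two_mul_d (n k : ℕ) (hkn : k ≤ n) : 2 * d n k = k * (2 * n + 3 - k) := by
  apply Nat.two_mul_div_two_of_even
  rcases Nat.even_or_odd k with h | h
  · exact h.mul_right _
  · refine Even.mul_left ?_ _
    obtain ⟨a, rfl⟩ := h
    exact ⟨n + 1 - a, by omega⟩

theorem Nn_eq_d_add (n k : ℕ) (hkn : k ≤ n) : Nn n = d n k + Nn (n - k) := by
  obtain ⟨a, rfl⟩ := Nat.exists_eq_add_of_le hkn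
  have h1 := two_mul_d (k + a) k hkn
  have h2 := two_mul_Nn (k + a)
  have h3 := two_mul_Nn a
  rw [show 2 * (k + a) + 3 - k = k + 2 * a + 3 by omega] at h1
  rw [Nat.add_sub_cancel_left]
  nlinarith

theorem card_zerosIn_add_card_nonzerosIn (X : Finset Pt) (q : Poly2) :
    (zerosIn X q).card + (nonzerosIn X q).card = X.card :=
  Finset.card_filter_add_card_filter_not _

/-- A curve of degree `k ≤ n` passes through at most `d n k` nodes of an `n`-correct set. -/
theorem IsNCorrect.card_zerosIn_le {n : ℕ} {X : Finset Pt} (hX : IsNCorrect n X) {r : Poly2}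
    (hr0 : r ≠ 0) (hr : r.totalDegree ≤ n) : (zerosIn X r).card ≤ d n r.totalDegree := by
  by_contra! hlt
  have h1 := card_zerosIn_add_card_nonzerosIn X r
  have h2 := Nn_eq_d_add n r.totalDegree hr
  obtain ⟨p, hp0, hpd, hp⟩ := exists_ne_zero_vanishing (n - r.totalDegree) (nonzerosIn X r)
    (by have := hX.1; omega)
  refine mul_ne_zero hp0 hr0 (hX.2 (p * r) ?_ fun P hP => ?_)
  · have := totalDegree_mul p r
    omega
  · rw [map_mul]
    by_cases h : eval P r = 0
    · rw [h, mul_zero]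
    · rw [hp P (Finset.mem_filter.mpr ⟨hP, h⟩), zero_mul]

theorem IsMaximalCurve.ne_zero {n k : ℕ} {X : Finset Pt} {q : Poly2} (hX : IsNCorrect n X)
    (hq : IsMaximalCurve n k X q) : q ≠ 0 := by
  rintro rfl
  obtain ⟨hk, hc⟩ := hq
  rw [totalDegree_zero] at hk
  subst hk
  have h := two_mul_Nn n
  simp [zerosIn, d, hX.1] at hc
  simp [hc] at h

theorem card_zerosIn_mul (X : Finset Pt) (s r : Poly2) :
    (zerosIn X (s * r)).card =
      (zerosIn X r).card + ((nonzerosIn X r).filter fun P => eval P s = 0).card := by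
  rw [← Finset.card_filter_add_card_filter_not (s := zerosIn X (s * r)) (fun P => eval P r = 0)]
  congr 2 <;> ext P <;> simp [zerosIn, nonzerosIn] <;> tauto

theorem d_add (n k m : ℕ) (hkn : k ≤ n) (hmk : m ≤ k) :
    d n k = d n (k - m) + d (n - k + m) m := by
  have h1 := Nn_eq_d_add n k hkn
  have h2 := Nn_eq_d_add n (k - m) (by omega)
  have h3 := Nn_eq_d_add (n - k + m) m (by omega)
  rw [show n - (k - m) = n - k + m by omega] at h2
  rw [Nat.add_sub_cancel] at h3
  omega

/-- if `q = s·r` is a maximal curve of degree `k ≤ n` for `X`, with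
`deg s = m ≤ k` and `deg r = k - m`, then `s` passes through at least `d(n-k+m, m)` nodes
of `X \ r`, and through exactly `d(n-k+m, m)` of them iff `r` is a maximal curve of
degree `k - m`. -/
theorem component_of_maximal_curve (n k m : ℕ) (X : Finset Pt) (hX : IsNCorrect n X)
    (q s r : Poly2) (hkn : k ≤ n) (hmk : m ≤ k)
    (hq : IsMaximalCurve n k X q) (hfact : q = s * r)
    (hs : s.totalDegree = m) (hr : r.totalDegree = k - m) :
    d (n - k + m) m ≤ ((nonzerosIn X r).filter fun P => eval P s = 0).card ∧
    (((nonzerosIn X r).filter fun P => eval P s = 0).card = d (n - k + m) m ↔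
      IsMaximalCurve n (k - m) X r) := by
  subst hfact
  have hr0 : r ≠ 0 := right_ne_zero_of_mul (hq.ne_zero hX)
  have hle := hX.card_zerosIn_le hr0 (by omega)
  rw [hr] at hle
  have hcard := hq.2
  rw [card_zerosIn_mul, d_add n k m hkn hmk] at hcard
  refine ⟨by omega, fun h => ⟨hr, by omega⟩, fun h => ?_⟩
  have := h.2
  omega
end
end

section
/- Let Y be an n-independent set of exactly d(n, k−1) + 2 points in ℝ² all lying on a curve of degree k, where k ≤ n. Then this curve is determined uniquely by the points: any two polynomials of degree at most k vanishing at all points of Y have the same zero set (are proportional). -/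
open MvPolynomial Finset
open scoped Classical BigOperators

noncomputable section

/-- The polynomials all of whose monomials have degree less than `m`. -/
def lowDegree (m : ℕ) : Submodule ℝ Poly2 :=
  restrictSupport ℝ {s : Fin 2 →₀ ℕ | s.degree < m}

lemma mem_lowDegree_succ {m : ℕ} {p : Poly2} :
    p ∈ lowDegree (m + 1) ↔ p.totalDegree ≤ m := by
  rw [lowDegree, mem_restrictSupport_iff, totalDegree, Finset.sup_le_iff]
  simp only [Set.subset_def, Finset.mem_coe, Set.mem_ofPred_eq, Nat.lt_succ_iff]
  rfl

lemma mem_lowDegree_of_totalDegree_lt {m : ℕ} {p : Poly2} (h : p.totalDegree < m) :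
    p ∈ lowDegree m := by
  obtain ⟨m, rfl⟩ : ∃ j, m = j + 1 := ⟨m - 1, by omega⟩
  exact mem_lowDegree_succ.2 (by omega)

lemma coe_biUnion_finsuppAntidiag (m : ℕ) :
    (((range m).biUnion fun i => finsuppAntidiag (univ : Finset (Fin 2)) i :
      Finset (Fin 2 →₀ ℕ)) : Set (Fin 2 →₀ ℕ)) = {s | s.degree < m} := by
  ext s
  simp [mem_finsuppAntidiag, Finsupp.degree_eq_sum]

instance (m : ℕ) : FiniteDimensional ℝ (lowDegree m) := by
  have : Finite {s : Fin 2 →₀ ℕ | s.degree < m} := by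
    rw [← coe_biUnion_finsuppAntidiag]
    exact Finset.finite_toSet _
  exact Module.Finite.of_basis (basisRestrictSupport ℝ {s : Fin 2 →₀ ℕ | s.degree < m})

lemma two_mul_finrank_lowDegree (m : ℕ) :
    2 * Module.finrank ℝ (lowDegree m) = m * (m + 1) := by
  have h : Module.finrank ℝ (lowDegree m) = ∑ i ∈ range m, (i + 1) := by
    rw [lowDegree, Module.finrank_eq_nat_card_basis
      (basisRestrictSupport ℝ {s : Fin 2 →₀ ℕ | s.degree < m}), ← coe_biUnion_finsuppAntidiag,
      Nat.card_coe_set_eq, Set.ncard_coe_finset, card_biUnion]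
    · refine sum_congr rfl fun i _ => ?_
      rw [card_finsuppAntidiag_nat_eq_choose]
      simp [add_comm 1 i]
    · intro i _ j _ hij
      refine disjoint_left.2 fun s hi hj => hij ?_
      exact (mem_finsuppAntidiag.1 hi).1.symm.trans (mem_finsuppAntidiag.1 hj).1
  rw [h]
  clear h
  induction m with
  | zero => simp
  | succ m ih =>
    rw [sum_range_succ, mul_add, ih]
    ring

/-- Evaluation of the polynomials of total degree at most `n` at the points of `Y`. -/
def evalOn (n : ℕ) (Y : Finset Pt) : lowDegree (n + 1) →ₗ[ℝ] (Y → ℝ) :=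
  (LinearMap.pi fun P : Y => (aeval (P : Pt)).toLinearMap) ∘ₗ (lowDegree (n + 1)).subtype

lemma evalOn_apply (n : ℕ) (Y : Finset Pt) (p : lowDegree (n + 1)) (P : Y) :
    evalOn n Y p P = eval (P : Pt) (p : Poly2) := by
  simp [evalOn, aeval_eq_eval]

lemma IsNIndependent.evalOn_surjective {n : ℕ} {Y : Finset Pt} (hY : IsNIndependent n Y) :
    Function.Surjective (evalOn n Y) := by
  rw [← LinearMap.range_eq_top, eq_top_iff, ← (Pi.basisFun ℝ Y).span_eq, Submodule.span_le]
  rintro _ ⟨A, rfl⟩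
  obtain ⟨p, hp, hA, h⟩ := hY A A.2
  refine ⟨(eval (A : Pt) p)⁻¹ • ⟨p, mem_lowDegree_succ.2 hp⟩, ?_⟩
  ext P
  rw [map_smul, Pi.smul_apply, evalOn_apply, Pi.basisFun_apply]
  by_cases hPA : P = A
  · subst hPA
    simp [hA]
  · simp [hPA, h P P.2 (fun e => hPA (Subtype.ext e))]

lemma IsNIndependent.finrank_ker_evalOn_add_card {n : ℕ} {Y : Finset Pt}
    (hY : IsNIndependent n Y) :
    Module.finrank ℝ (LinearMap.ker (evalOn n Y)) + Y.card =
      Module.finrank ℝ (lowDegree (n + 1)) := by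
  have h := (evalOn n Y).finrank_range_add_finrank_ker
  rw [LinearMap.range_eq_top.2 hY.evalOn_surjective, finrank_top] at h
  simp only [Module.finrank_fintype_fun_eq_card, Fintype.card_coe] at h
  omega

/-- The map `(a, b) ↦ p a + q b` on pairs of polynomials of total degree at most `m`. -/
def combination (m : ℕ) (p q : Poly2) : (lowDegree (m + 1) × lowDegree (m + 1)) →ₗ[ℝ] Poly2 :=
  (LinearMap.mulLeft ℝ p ∘ₗ (lowDegree (m + 1)).subtype).coprod
    (LinearMap.mulLeft ℝ q ∘ₗ (lowDegree (m + 1)).subtype)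

lemma combination_apply (m : ℕ) (p q : Poly2) (x : lowDegree (m + 1) × lowDegree (m + 1)) :
    combination m p q x = p * x.1 + q * x.2 := by
  simp [combination]

lemma finrank_range_combination_le {m k n : ℕ} (hn : m + k = n) {Y : Finset Pt} {p q : Poly2}
    (hp : p.totalDegree ≤ k) (hq : q.totalDegree ≤ k)
    (hpY : ∀ P ∈ Y, eval P p = 0) (hqY : ∀ P ∈ Y, eval P q = 0) :
    Module.finrank ℝ (LinearMap.range (combination m p q)) ≤
      Module.finrank ℝ (LinearMap.ker (evalOn n Y)) := by
  have hle : LinearMap.range (combination m p q) ≤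
      (LinearMap.ker (evalOn n Y)).map (lowDegree (n + 1)).subtype := by
    rintro _ ⟨⟨⟨a, ha⟩, ⟨b, hb⟩⟩, rfl⟩
    rw [combination_apply]
    have ha' := mem_lowDegree_succ.1 ha
    have hb' := mem_lowDegree_succ.1 hb
    have hdeg : (p * a + q * b).totalDegree ≤ n := by
      refine (totalDegree_add _ _).trans (max_le ?_ ?_)
      · exact (totalDegree_mul _ _).trans (by omega)
      · exact (totalDegree_mul _ _).trans (by omega)
    refine ⟨⟨p * a + q * b, mem_lowDegree_succ.2 hdeg⟩, ?_, rfl⟩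
    refine LinearMap.mem_ker.2 (funext fun P => ?_)
    simp [evalOn_apply, hpY P P.2, hqY P P.2]
  exact (Submodule.finrank_mono hle).trans (Submodule.finrank_map_le _ _)

/-- The syzygies of two non-proportional polynomials `p = g p'`, `q = g q'`, with `p'`, `q'`
coprime, are the pairs `(q' c, -p' c)`, so `c` has smaller degree than the syzygy. -/
lemma finrank_ker_combination_le {m : ℕ} {p q : Poly2} (hp : p ≠ 0) (hq : q ≠ 0)
    (h : ¬∃ c : ℝ, c ≠ 0 ∧ q = c • p) :
    Module.finrank ℝ (LinearMap.ker (combination m p q)) ≤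
      Module.finrank ℝ (lowDegree m) := by
  obtain ⟨p', q', g, hrel, rfl, rfl⟩ := UniqueFactorizationMonoid.exists_reduced_factors' p q hq
  have hg : g ≠ 0 := left_ne_zero_of_mul hp
  have hp' : p' ≠ 0 := right_ne_zero_of_mul hp
  have hq' : q' ≠ 0 := right_ne_zero_of_mul hq
  have hpos : 0 < p'.totalDegree ∨ 0 < q'.totalDegree := by
    by_contra! hzero
    have hpC := totalDegree_eq_zero_iff_eq_C.1 (Nat.le_zero.1 hzero.1)
    have hqC := totalDegree_eq_zero_iff_eq_C.1 (Nat.le_zero.1 hzero.2)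
    have hp0 : p'.coeff 0 ≠ 0 := fun e => hp' (by rw [hpC, e, C_0])
    have hq0 : q'.coeff 0 ≠ 0 := fun e => hq' (by rw [hqC, e, C_0])
    refine h ⟨q'.coeff 0 / p'.coeff 0, div_ne_zero hq0 hp0, ?_⟩
    rw [← mul_smul_comm]
    congr 1
    rw [smul_eq_C_mul]
    conv_rhs => rw [hpC]
    rw [← C_mul, coeff_C, if_pos rfl, div_mul_cancel₀ _ hp0]
    exact hqC
  let S : (lowDegree (m + 1) × lowDegree (m + 1)) →ₗ[ℝ] (Poly2 × Poly2) :=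
    (lowDegree (m + 1)).subtype.prodMap (lowDegree (m + 1)).subtype
  have hS : Function.Injective S :=
    Subtype.val_injective.prodMap Subtype.val_injective
  let L : Poly2 →ₗ[ℝ] (Poly2 × Poly2) :=
    (LinearMap.mulLeft ℝ q').prod (LinearMap.mulLeft ℝ (-p'))
  have hle : (LinearMap.ker (combination m (g * p') (g * q'))).map S ≤ (lowDegree m).map L := by
    rintro _ ⟨⟨⟨a, ha⟩, ⟨b, hb⟩⟩, hab, rfl⟩
    have hab' : g * p' * a + g * q' * b = 0 := by
      simpa [combination_apply] using hab
    have hrel' : p' * a + q' * b = 0 :=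
      (mul_eq_zero.1 (by linear_combination hab' : g * (p' * a + q' * b) = 0)).resolve_left hg
    obtain ⟨c, rfl⟩ : q' ∣ a :=
      hrel.symm.dvd_of_dvd_mul_left ⟨-b, by linear_combination hrel'⟩
    have hbc : b = -p' * c :=
      mul_left_cancel₀ hq' (by linear_combination hrel')
    refine ⟨c, ?_, Prod.ext rfl (by simp [L, S, hbc])⟩
    by_cases hc : c = 0
    · rw [hc]
      exact zero_mem _
    · have hda := mem_lowDegree_succ.1 ha
      have hdb := mem_lowDegree_succ.1 hb
      rw [totalDegree_mul_of_isDomain hq' hc] at hda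
      rw [hbc, totalDegree_mul_of_isDomain (neg_ne_zero.2 hp') hc, totalDegree_neg] at hdb
      exact mem_lowDegree_of_totalDegree_lt (by omega)
  rw [(Submodule.equivMapOfInjective S hS _).finrank_eq]
  exact (Submodule.finrank_mono hle).trans (Submodule.finrank_map_le _ _)

/-- an `n`-independent set of `d(n, k-1) + 2` points lying on a curve of
degree `k ≤ n` determines that curve uniquely: any two (nonzero) polynomials of degree at
most `k` vanishing at all the points are proportional. -/
theorem curve_determined_uniquely (n k : ℕ) (Y : Finset Pt) (hkn : k ≤ n)
    (hind : IsNIndependent n Y) (hcard : Y.card = d n (k - 1) + 2)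
    (hcurve : ∃ f : Poly2, f.totalDegree = k ∧ ∀ P ∈ Y, eval P f = 0) :
    ∀ p q : Poly2, p ≠ 0 → q ≠ 0 → p.totalDegree ≤ k → q.totalDegree ≤ k →
      (∀ P ∈ Y, eval P p = 0) → (∀ P ∈ Y, eval P q = 0) →
      ∃ c : ℝ, c ≠ 0 ∧ q = c • p := by
  intro p q hp hq hpk hqk hpY hqY
  by_contra hpq
  rcases Nat.eq_zero_or_pos k with rfl | hk
  · obtain ⟨P, hP⟩ : Y.Nonempty := card_pos.1 (by omega)
    have hpC := totalDegree_eq_zero_iff_eq_C.1 (Nat.le_zero.1 hpk)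
    have h0 := hpY P hP
    rw [hpC, eval_C] at h0
    exact hp (by rw [hpC, h0, C_0])
  obtain ⟨j, rfl⟩ : ∃ j, k = j + 1 := ⟨k - 1, by omega⟩
  obtain ⟨m, rfl⟩ := Nat.exists_eq_add_of_le' hkn
  have hrange := finrank_range_combination_le (m := m) rfl hpk hqk hpY hqY
  have hker := finrank_ker_combination_le (m := m) hp hq hpq
  have hsum := (combination m p q).finrank_range_add_finrank_ker
  rw [Module.finrank_prod] at hsum
  have hY := hind.finrank_ker_evalOn_add_card
  have h1 := two_mul_finrank_lowDegree m
  have h2 := two_mul_finrank_lowDegree (m + 1)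
  have h3 := two_mul_finrank_lowDegree (m + (j + 1) + 1)
  have hd : 2 * d (m + (j + 1)) j = j * (j + 5 + 2 * m) := by
    have hsub : 2 * (m + (j + 1)) + 3 - j = j + 5 + 2 * m := by omega
    rw [d, hsub]
    refine Nat.mul_div_cancel' ?_
    have hev : Even (j * (j + 5 + 2 * m)) := by
      rw [Nat.even_mul]
      grind
    exact hev.two_dvd
  rw [Nat.add_sub_cancel] at hcard
  nlinarith
end
end

section
/- Let X be an n-correct set and let ℓ be a 2-node line of X. Then ℓ is used by at most one node of X: if C₁, C₂ ∈ X both use ℓ, then C₁ = C₂. -/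
open MvPolynomial Finset
open scoped Classical BigOperators

noncomputable section

/-- A polynomial of total degree at most one is an affine function. -/
lemma exists_eval_eq_affine {p : Poly2} (hp : p.totalDegree ≤ 1) :
    ∃ a b c : ℝ, ∀ P : Pt, eval P p = a + b * P 0 + c * P 1 := by
  have hp' : p = C (coeff 0 p) + C (coeff (Finsupp.single 0 1) p) * X 0
      + C (coeff (Finsupp.single 1 1) p) * X 1 := by
    ext m
    simp only [coeff_add, coeff_C, coeff_C_mul, coeff_X]
    rcases lt_or_ge 1 m.degree with hm | hm
    · have h0 : coeff m p = 0 := coeff_eq_zero_of_totalDegree_lt (lt_of_le_of_lt hp hm)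
      have h1 : 0 ≠ m := by rintro rfl; simp at hm
      have h2 : ∀ i : Fin 2, Finsupp.single i 1 ≠ m := by rintro i rfl; simp at hm
      simp [h0, h1, h2]
    · rcases Nat.le_one_iff_eq_zero_or_eq_one.mp hm with h | h
      · obtain rfl : m = 0 := (Finsupp.degree_eq_zero_iff m).mp h
        simp
      · obtain ⟨i, rfl⟩ := (Finsupp.sum_eq_one_iff m).mp h
        have h1 : ∀ j : Fin 2, (0 : Fin 2 →₀ ℕ) ≠ Finsupp.single j 1 := fun j => by simp [eq_comm]
        fin_cases i <;> simp [h1, Finsupp.single_left_inj]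
  refine ⟨coeff 0 p, coeff (Finsupp.single 0 1) p, coeff (Finsupp.single 1 1) p, fun P => ?_⟩
  conv_lhs => rw [hp']
  simp only [map_add, map_mul, eval_C, eval_X]

/-- A polynomial of degree at most `n` vanishing at all nodes but one is a multiple of the
fundamental polynomial of that node. -/
lemma IsNCorrect.eq_C_mul_fund {n : ℕ} {X : Finset Pt} (hX : IsNCorrect n X) {A : Pt}
    {f p : Poly2} (hf : IsFund n X A f) (hp : p.totalDegree ≤ n)
    (h : ∀ P ∈ X, P ≠ A → eval P p = 0) : p = C (eval A p) * f := by
  refine sub_eq_zero.mp (hX.2 _ ?_ fun P hP => ?_)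
  · refine (totalDegree_sub _ _).trans (max_le hp ((totalDegree_mul _ _).trans ?_))
    simpa using hf.1
  · by_cases hPA : P = A
    · subst hPA; simp [hf.2.1]
    · simp [h P hP hPA, hf.2.2 P hP hPA]

/-- A polynomial of degree less than `n` cannot vanish at all nodes but two. -/
lemma IsNCorrect.eq_zero_of_vanish_off_pair {n : ℕ} {X : Finset Pt} (hX : IsNCorrect n X)
    {A B : Pt} {f q : Poly2} (hf : IsFund n X A f) (hq : q.totalDegree + 1 ≤ n)
    (h : ∀ P ∈ X, P ≠ A → P ≠ B → eval P q = 0) : q = 0 := by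
  have key : ∀ i : Fin 2, (MvPolynomial.X i - C (B i)) * q =
      C (eval A ((MvPolynomial.X i - C (B i)) * q)) * f := fun i => by
    refine hX.eq_C_mul_fund hf ?_ fun P hP hPA => ?_
    · have h1 := totalDegree_sub_C_le (MvPolynomial.X i : Poly2) (B i)
      rw [totalDegree_X] at h1
      have := totalDegree_mul (MvPolynomial.X i - C (B i)) q
      lia
    · by_cases hPB : P = B
      · simp [hPB]
      · simp [h P hP hPA hPB]
  by_contra hq0
  set c := fun i : Fin 2 => eval A ((MvPolynomial.X i - C (B i)) * q)
  have h01 : (C (c 1) * (MvPolynomial.X 0 - C (B 0)) : Poly2) =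
      C (c 0) * (MvPolynomial.X 1 - C (B 1)) := by
    refine mul_right_cancel₀ hq0 ?_
    linear_combination C (c 1) * key 0 - C (c 0) * key 1
  have hc : c 0 = 0 := by
    have := congrArg (eval ![B 0, B 1 + 1]) h01
    simpa using this.symm
  have h0 := key 0
  change _ = C (c 0) * f at h0
  rw [hc, C_0, zero_mul, mul_eq_zero, or_iff_left hq0] at h0
  have := congrArg (eval ![B 0 + 1, 0]) h0
  simp at this

/-- If `m` and `ℓ`, of degree at most one, both vanish at `B`, while `ℓ` but not `m` vanishes
at `A`, and `ℓ` divides `m * q`, then `q` vanishes at `B`. -/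
lemma eval_eq_zero_of_dvd_mul {m ℓ q : Poly2} {A B : Pt} (hm : m.totalDegree ≤ 1)
    (hℓ : ℓ.totalDegree ≤ 1) (hmB : eval B m = 0) (hℓB : eval B ℓ = 0) (hℓA : eval A ℓ = 0)
    (hmA : eval A m ≠ 0) (hdvd : ℓ ∣ m * q) : eval B q = 0 := by
  obtain ⟨r, hr⟩ := hdvd
  obtain ⟨a, b, c, hm'⟩ := exists_eval_eq_affine hm
  obtain ⟨a', b', c', hℓ'⟩ := exists_eval_eq_affine hℓ
  have hzero : ∀ t : ℝ, t ≠ 0 → eval (B + t • (A - B)) q = 0 := fun t ht => by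
    have h1 : eval (B + t • (A - B)) ℓ = 0 := by
      rw [hℓ'] at hℓA hℓB ⊢
      simp only [Pi.add_apply, Pi.smul_apply, Pi.sub_apply, smul_eq_mul]
      linear_combination t * hℓA + (1 - t) * hℓB
    have h2 : eval (B + t • (A - B)) m = t * eval A m := by
      rw [hm'] at hmB ⊢
      rw [hm']
      simp only [Pi.add_apply, Pi.smul_apply, Pi.sub_apply, smul_eq_mul]
      linear_combination (1 - t) * hmB
    have h3 := congrArg (eval (B + t • (A - B))) hr
    rw [map_mul, map_mul, h1, h2, zero_mul] at h3
    exact (mul_eq_zero.mp h3).resolve_left (mul_ne_zero ht hmA)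
  have hcont : Continuous fun t : ℝ => eval (B + t • (A - B)) q :=
    (continuous_eval q).comp (by fun_prop)
  have heq := hcont.ext_on (dense_compl_singleton (0 : ℝ)) continuous_const
    (g := fun _ => 0) fun t ht => hzero t ht
  simpa using congrFun heq 0

/-- Through any two points `P`, `Q` passes a curve of degree at most one on which every other
point is collinear with `P` and `Q`. -/
lemma exists_affine_through (P Q : Pt) (hPQ : P ≠ Q) :
    ∃ m : Poly2, m.totalDegree ≤ 1 ∧ eval P m = 0 ∧ eval Q m = 0 ∧
      ∀ R, eval R m = 0 → ∃ t : ℝ, R = P + t • (Q - P) := by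
  refine ⟨C (Q 1 - P 1) * (X 0 - C (P 0)) - C (Q 0 - P 0) * (X 1 - C (P 1)), ?_, by simp,
    by simp; ring, fun R hR => ?_⟩
  · have h : ∀ (i : Fin 2) (a b : ℝ), (C a * (X i - C b) : Poly2).totalDegree ≤ 1 :=
      fun i a b => by
        have h1 := totalDegree_sub_C_le (X i : Poly2) b
        rw [totalDegree_X] at h1
        have h2 := totalDegree_mul (C a) (X i - C b : Poly2)
        rw [totalDegree_C] at h2
        lia
    exact (totalDegree_sub _ _).trans (max_le (h _ _ _) (h _ _ _))
  · simp only [map_sub, map_mul, eval_C, eval_X] at hR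
    by_cases h0 : Q 0 - P 0 = 0
    · have h1 : Q 1 - P 1 ≠ 0 := fun h1 => hPQ <| by
        ext i
        fin_cases i
        · exact (sub_eq_zero.mp h0).symm
        · exact (sub_eq_zero.mp h1).symm
      refine ⟨(R 1 - P 1) / (Q 1 - P 1), ?_⟩
      ext i
      fin_cases i <;> simp <;> field_simp
      · linear_combination hR
      · ring
    · refine ⟨(R 0 - P 0) / (Q 0 - P 0), ?_⟩
      ext i
      fin_cases i <;> simp <;> field_simp
      · ring
      · linear_combination -hR

/-- a `2`-node line of an `n`-correct set can be used by at most one node. -/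
theorem two_node_line_used_once (n : ℕ) (X : Finset Pt) (hX : IsNCorrect n X)
    (ℓ : Poly2) (A B : Pt) (h2 : IsTwoNodeLineOf X ℓ A B)
    (C₁ C₂ : Pt) (hC₁ : C₁ ∈ X) (hC₂ : C₂ ∈ X)
    (hu₁ : Uses n X C₁ ℓ) (hu₂ : Uses n X C₂ ℓ) :
    C₁ = C₂ := by
  by_contra hne
  obtain ⟨hline, hAB, hz⟩ := h2
  obtain ⟨f₁, hf₁, q₁, rfl⟩ := hu₁
  obtain ⟨f₂, hf₂, q₂, rfl⟩ := hu₂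
  have hon : ∀ P, P ∈ X ∧ eval P ℓ = 0 ↔ P = A ∨ P = B := fun P => by
    simpa [zerosIn] using Finset.ext_iff.mp hz P
  have hℓA := ((hon A).mpr (Or.inl rfl)).2
  have hℓB := ((hon B).mpr (Or.inr rfl)).2
  have hdeg : ∀ {P : Pt} {q : Poly2}, IsFund n X P (ℓ * q) → q.totalDegree + 1 ≤ n := by
    intro P q hf
    have h0 : ℓ * q ≠ 0 := fun h => by simpa [h] using hf.2.1
    have := hf.1
    rw [totalDegree_mul_of_isDomain (left_ne_zero_of_mul h0) (right_ne_zero_of_mul h0),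
      show ℓ.totalDegree = 1 from hline] at this
    lia
  have hvan : ∀ {Q : Pt} {q : Poly2}, IsFund n X Q (ℓ * q) →
      ∀ P ∈ X, P ≠ Q → P ≠ A → P ≠ B → eval P q = 0 := by
    intro Q q hf P hP hPQ hPA hPB
    have h := hf.2.2 P hP hPQ
    rw [map_mul] at h
    refine (mul_eq_zero.mp h).resolve_left fun hl => ?_
    rcases (hon P).mp ⟨hP, hl⟩ with h | h <;> contradiction
  have hne0 : ∀ {Q : Pt} {q : Poly2}, IsFund n X Q (ℓ * q) →
      eval Q ℓ ≠ 0 ∧ eval Q q ≠ 0 := by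
    intro Q q hf
    have h := hf.2.1
    rw [map_mul] at h
    exact ⟨left_ne_zero_of_mul_eq_one h, right_ne_zero_of_mul_eq_one h⟩
  obtain ⟨hℓ₁, hq₁⟩ := hne0 hf₁
  obtain ⟨hℓ₂, hq₂⟩ := hne0 hf₂
  have hoff : ∀ {Q : Pt}, eval Q ℓ ≠ 0 → Q ≠ A ∧ Q ≠ B := fun h =>
    ⟨fun e => h (e ▸ hℓA), fun e => h (e ▸ hℓB)⟩
  have hq₁₂ := hvan hf₁ C₂ hC₂ (Ne.symm hne) (hoff hℓ₂).1 (hoff hℓ₂).2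
  have hq₂₁ := hvan hf₂ C₁ hC₁ hne (hoff hℓ₁).1 (hoff hℓ₁).2
  obtain ⟨a, b, hab, habA⟩ : ∃ a b : ℝ, (a ≠ 0 ∨ b ≠ 0) ∧
      a * eval A q₁ + b * eval A q₂ = 0 := by
    by_cases h : eval A q₁ = 0
    · exact ⟨1, 0, by simp, by simp [h]⟩
    · exact ⟨-eval A q₂, eval A q₁, Or.inr h, by ring⟩
  set q : Poly2 := C a * q₁ + C b * q₂ with hq
  have hqdeg : q.totalDegree + 1 ≤ n := by
    have h1 := totalDegree_mul (C a) q₁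
    have h2 := totalDegree_mul (C b) q₂
    have h3 := totalDegree_add (C a * q₁) (C b * q₂)
    have := hdeg hf₁
    have := hdeg hf₂
    rw [totalDegree_C] at h1 h2
    rw [← hq] at h3
    lia
  have hqA : eval A q = 0 := by simpa [hq] using habA
  have hqX : ∀ P ∈ X, P ≠ C₁ → P ≠ C₂ → P ≠ B → eval P q = 0 := by
    intro P hP h1 h2 hPB
    by_cases hPA : P = A
    · rwa [hPA]
    · simp [hq, hvan hf₁ P hP h1 hPA hPB, hvan hf₂ P hP h2 hPA hPB]
  have hqB : eval B q = 0 := by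
    obtain ⟨m, hm, hmB, hmC, hmcol⟩ := exists_affine_through B C₂ (Ne.symm (hoff hℓ₂).2)
    have hmA : eval A m ≠ 0 := fun h => by
      obtain ⟨t, ht⟩ := hmcol A h
      obtain ⟨u, v, w, hℓ'⟩ := exists_eval_eq_affine (le_of_eq hline)
      have ht0 : t ≠ 0 := by
        rintro rfl
        exact hAB (by simpa using ht)
      have e0 := congrFun ht 0
      have e1 := congrFun ht 1
      simp only [Pi.add_apply, Pi.smul_apply, Pi.sub_apply, smul_eq_mul] at e0 e1
      refine hℓ₂ (mul_left_cancel₀ ht0 ?_)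
      rw [hℓ'] at hℓA hℓB ⊢
      linear_combination hℓA - (1 - t) * hℓB - v * e0 - w * e1
    have hmq := hX.eq_C_mul_fund hf₁ (p := m * q)
      ((totalDegree_mul _ _).trans (by lia)) fun P hP hP1 => by
        by_cases h2 : P = C₂
        · simp [h2, hmC]
        · by_cases hPB : P = B
          · simp [hPB, hmB]
          · simp [hqX P hP hP1 h2 hPB]
    refine eval_eq_zero_of_dvd_mul hm (le_of_eq hline) hmB hℓB hℓA hmA ?_
    rw [hmq]
    exact (dvd_mul_right ℓ q₁).mul_left _
  have hq0 : q = 0 := hX.eq_zero_of_vanish_off_pair (B := C₂) hf₁ hqdeg fun P hP h1 h2 => by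
    by_cases hPB : P = B
    · rwa [hPB]
    · exact hqX P hP h1 h2 hPB
  rcases hab with h | h
  · have := congrArg (eval C₁) hq0
    simp [hq, hq₂₁, h, hq₁] at this
  · have := congrArg (eval C₂) hq0
    simp [hq, hq₁₂, h, hq₂] at this
end
end
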